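/- Let L > 0 and let α, β, γ, δ, c, ε be real constants with γ ≠ 0. Suppose U, W : ℝ × ℝ → ℝ are five times continuously differentiable, satisfy the potential coupled Boussinesq system at every point, satisfy U(−L, t) = W(−L, t) = 0 for all t, and u := U_x and w := W_x are 2L-periodic in x for every t. Then for every t, d/dt ∫_{−L}^{L} (1/2)[ U_t² + (δ/γ) W_t² + u² + (δc²/γ) w² + (ε/3)( u³ + (αδ/γ) w³ ) + ε u_t² + (εβδ/γ) w_t² + εδ (U − W)² ] dx = U_t(L,t)[ u(L,t) + (ε/2) u(L,t)² + ε u_tt(L,t) ] + W_t(L,t)[ (δc²/γ) w(L,t) + (εαδ/(2γ)) w(L,t)² + (εβδ/γ) w_tt(L,t) ] (the nonlocal energy conservation law). -/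

import Mathlib

/-- Partial derivative in the first variable (space `x`). -/
noncomputable def pd1 (f : ℝ → ℝ → ℝ) (x y : ℝ) : ℝ := deriv (fun x' => f x' y) x

/-- Partial derivative in the second variable (time `t`). -/
noncomputable def pd2 (f : ℝ → ℝ → ℝ) (x y : ℝ) : ℝ := deriv (fun y' => f x y') y

/-- The potential coupled Boussinesq system:
`U_tt − U_xx = ε[ U_x U_xx + U_ttxx − δ(U − W) ]`,
`W_tt − c² W_xx = ε[ α W_x W_xx + β W_ttxx + γ(U − W) ]`. -/
def potCB (α β γ δ c ε : ℝ) (U W : ℝ → ℝ → ℝ) : Prop :=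
  ∀ x t : ℝ,
    pd2 (pd2 U) x t - pd1 (pd1 U) x t
      = ε * (pd1 U x t * pd1 (pd1 U) x t + pd1 (pd1 (pd2 (pd2 U))) x t
          - δ * (U x t - W x t)) ∧
    pd2 (pd2 W) x t - c ^ 2 * pd1 (pd1 W) x t
      = ε * (α * pd1 W x t * pd1 (pd1 W) x t + β * pd1 (pd1 (pd2 (pd2 W))) x t
          + γ * (U x t - W x t))

open Function

section PartialDerivatives

variable {f : ℝ → ℝ → ℝ}

theorem hasDerivAt_fst_fderiv (hf : Differentiable ℝ (uncurry f)) (x y : ℝ) :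
    HasDerivAt (fun x' => f x' y) (fderiv ℝ (uncurry f) (x, y) (1, 0)) x :=
  HasFDerivAt.comp_hasDerivAt (l := uncurry f) x (hf (x, y)).hasFDerivAt
    ((hasDerivAt_id x).prodMk (hasDerivAt_const x y))

theorem hasDerivAt_snd_fderiv (hf : Differentiable ℝ (uncurry f)) (x y : ℝ) :
    HasDerivAt (fun y' => f x y') (fderiv ℝ (uncurry f) (x, y) (0, 1)) y :=
  (hf (x, y)).hasFDerivAt.comp_hasDerivAt y ((hasDerivAt_const y x).prodMk (hasDerivAt_id y))

theorem hasDerivAt_pd1 (hf : Differentiable ℝ (uncurry f)) (x y : ℝ) :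
    HasDerivAt (fun x' => f x' y) (pd1 f x y) x :=
  (hasDerivAt_fst_fderiv hf x y).differentiableAt.hasDerivAt

theorem hasDerivAt_pd2 (hf : Differentiable ℝ (uncurry f)) (x y : ℝ) :
    HasDerivAt (fun y' => f x y') (pd2 f x y) y :=
  (hasDerivAt_snd_fderiv hf x y).differentiableAt.hasDerivAt

theorem uncurry_pd1_eq_fderiv (hf : Differentiable ℝ (uncurry f)) :
    uncurry (pd1 f) = fun p => fderiv ℝ (uncurry f) p (1, 0) :=
  funext fun p => (hasDerivAt_fst_fderiv hf p.1 p.2).deriv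

theorem uncurry_pd2_eq_fderiv (hf : Differentiable ℝ (uncurry f)) :
    uncurry (pd2 f) = fun p => fderiv ℝ (uncurry f) p (0, 1) :=
  funext fun p => (hasDerivAt_snd_fderiv hf p.1 p.2).deriv

theorem ContDiff.uncurry_pd1 {m n : WithTop ℕ∞} (hf : ContDiff ℝ n (uncurry f))
    (hmn : m + 1 ≤ n) : ContDiff ℝ m (uncurry (pd1 f)) := by
  rw [uncurry_pd1_eq_fderiv ((hf.of_le (le_add_self.trans hmn)).differentiable one_ne_zero)]
  exact (hf.fderiv_right hmn).clm_apply contDiff_const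

theorem ContDiff.uncurry_pd2 {m n : WithTop ℕ∞} (hf : ContDiff ℝ n (uncurry f))
    (hmn : m + 1 ≤ n) : ContDiff ℝ m (uncurry (pd2 f)) := by
  rw [uncurry_pd2_eq_fderiv ((hf.of_le (le_add_self.trans hmn)).differentiable one_ne_zero)]
  exact (hf.fderiv_right hmn).clm_apply contDiff_const

/-- Equality of mixed partial derivatives. -/
theorem pd1_pd2_comm (hf : ContDiff ℝ 2 (uncurry f)) : pd1 (pd2 f) = pd2 (pd1 f) := by
  have hd : Differentiable ℝ (uncurry f) := hf.differentiable two_ne_zero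
  have hdd : Differentiable ℝ (fderiv ℝ (uncurry f)) :=
    (hf.fderiv_right (m := 1) (by norm_num)).differentiable one_ne_zero
  have hd1 := (hf.uncurry_pd1 (m := 1) (by norm_num)).differentiable one_ne_zero
  have hd2 := (hf.uncurry_pd2 (m := 1) (by norm_num)).differentiable one_ne_zero
  have key (p v w : ℝ × ℝ) : fderiv ℝ (fun q => fderiv ℝ (uncurry f) q v) p w
      = fderiv ℝ (fderiv ℝ (uncurry f)) p w v := by
    rw [((hdd p).hasFDerivAt.clm_apply (hasFDerivAt_const v p)).fderiv]
    simp
  ext x y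
  rw [pd1, (hasDerivAt_fst_fderiv hd2 x y).deriv, pd2, (hasDerivAt_snd_fderiv hd1 x y).deriv,
    uncurry_pd1_eq_fderiv hd, uncurry_pd2_eq_fderiv hd, key, key]
  exact second_derivative_symmetric (fun p => (hd p).hasFDerivAt) (hdd (x, y)).hasFDerivAt _ _

/-- Differentiation under the integral sign for `C¹` integrands on a compact interval. -/
theorem hasDerivAt_integral_pd2 (hf : ContDiff ℝ 1 (uncurry f)) (a b t : ℝ) :
    HasDerivAt (fun s => ∫ x in a..b, f x s) (∫ x in a..b, pd2 f x t) t := by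
  have hd : Continuous (uncurry (pd2 f)) := (hf.uncurry_pd2 (m := 0) (by norm_num)).continuous
  have hslice {g : ℝ → ℝ → ℝ} (hg : Continuous (uncurry g)) (s : ℝ) :
      Continuous fun x => g x s := hg.comp (Continuous.prodMk_left s)
  obtain ⟨C, hC⟩ := (isCompact_uIcc.prod (isCompact_closedBall t 1)).exists_bound_of_continuousOn
    (hd.continuousOn (s := Set.uIcc a b ×ˢ Metric.closedBall t 1))
  refine (intervalIntegral.hasDerivAt_integral_of_dominated_loc_of_deriv_le
    (F := fun s x => f x s) (F' := fun s x => pd2 f x s) (bound := fun _ => C)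
    (Metric.closedBall_mem_nhds t one_pos)
    (.of_forall fun s => (hslice hf.continuous s).aestronglyMeasurable)
    ((hslice hf.continuous t).intervalIntegrable a b)
    (hslice hd t).aestronglyMeasurable
    (.of_forall fun x hx s hs => hC (x, s) ⟨Set.uIoc_subset_uIcc hx, hs⟩)
    intervalIntegrable_const
    (.of_forall fun x _ s _ => hasDerivAt_pd2 (hf.differentiable one_ne_zero) x s)).2

/-- Integrated form of a local conservation law with density `f` and flux `-g`. -/
theorem deriv_integral_of_pd2_eq_pd1 {g : ℝ → ℝ → ℝ} (hf : ContDiff ℝ 1 (uncurry f))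
    (hg : ContDiff ℝ 1 (uncurry g)) (h : ∀ x t, pd2 f x t = pd1 g x t) (a b t : ℝ) :
    deriv (fun s => ∫ x in a..b, f x s) t = g b t - g a t := by
  have hc : Continuous (uncurry (pd1 g)) := (hg.uncurry_pd1 (m := 0) (by norm_num)).continuous
  rw [(hasDerivAt_integral_pd2 hf a b t).deriv]
  simp only [h]
  exact intervalIntegral.integral_eq_sub_of_hasDerivAt
    (fun x _ => hasDerivAt_pd1 (hg.differentiable one_ne_zero) x t)
    ((hc.comp (Continuous.prodMk_left t)).intervalIntegrable a b)

end PartialDerivatives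

/-- Nonlocal energy conservation law for C⁵ solutions of the potential coupled
Boussinesq system with `U(−L,t) = W(−L,t) = 0` and `u = U_x`, `w = W_x`
`2L`-periodic in `x`. -/
theorem stmt10 (L α β γ δ c ε : ℝ) (hL : 0 < L) (hγ : γ ≠ 0) (U W : ℝ → ℝ → ℝ)
    (hU : ContDiff ℝ 5 (Function.uncurry U)) (hW : ContDiff ℝ 5 (Function.uncurry W))
    (hsys : potCB α β γ δ c ε U W)
    (hUb : ∀ t, U (-L) t = 0) (hWb : ∀ t, W (-L) t = 0)
    (hup : ∀ x t, pd1 U (x + 2 * L) t = pd1 U x t)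
    (hwp : ∀ x t, pd1 W (x + 2 * L) t = pd1 W x t) :
    ∀ t : ℝ,
      deriv (fun s => ∫ x in (-L)..L,
          (1 / 2) * ((pd2 U x s) ^ 2 + (δ / γ) * (pd2 W x s) ^ 2
            + (pd1 U x s) ^ 2 + (δ * c ^ 2 / γ) * (pd1 W x s) ^ 2
            + (ε / 3) * ((pd1 U x s) ^ 3 + (α * δ / γ) * (pd1 W x s) ^ 3)
            + ε * (pd2 (pd1 U) x s) ^ 2 + (ε * β * δ / γ) * (pd2 (pd1 W) x s) ^ 2
            + ε * δ * (U x s - W x s) ^ 2)) t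
        = pd2 U L t * (pd1 U L t + (ε / 2) * (pd1 U L t) ^ 2
              + ε * pd2 (pd2 (pd1 U)) L t)
          + pd2 W L t * ((δ * c ^ 2 / γ) * pd1 W L t
              + (ε * α * δ / (2 * γ)) * (pd1 W L t) ^ 2
              + (ε * β * δ / γ) * pd2 (pd2 (pd1 W)) L t) := by
  intro t
  have smooth {V : ℝ → ℝ → ℝ} (hV : ContDiff ℝ 5 (uncurry V)) :
      ContDiff ℝ 1 (uncurry V) ∧ ContDiff ℝ 1 (uncurry (pd1 V)) ∧
      ContDiff ℝ 1 (uncurry (pd2 V)) ∧ ContDiff ℝ 1 (uncurry (pd2 (pd1 V))) ∧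
      ContDiff ℝ 1 (uncurry (pd2 (pd2 (pd1 V)))) := by
    have h1 : ContDiff ℝ 4 (uncurry (pd1 V)) := hV.uncurry_pd1 (by norm_num)
    have h2 : ContDiff ℝ 4 (uncurry (pd2 V)) := hV.uncurry_pd2 (by norm_num)
    have h21 : ContDiff ℝ 3 (uncurry (pd2 (pd1 V))) := h1.uncurry_pd2 (by norm_num)
    have h221 : ContDiff ℝ 2 (uncurry (pd2 (pd2 (pd1 V)))) := h21.uncurry_pd2 (by norm_num)
    exact ⟨hV.of_le (by norm_num), h1.of_le (by norm_num), h2.of_le (by norm_num),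
      h21.of_le (by norm_num), h221.of_le (by norm_num)⟩
  have comm {V : ℝ → ℝ → ℝ} (hV : ContDiff ℝ 5 (uncurry V)) :
      pd1 (pd2 V) = pd2 (pd1 V) ∧ pd1 (pd2 (pd2 V)) = pd2 (pd2 (pd1 V)) := by
    have h2 : ContDiff ℝ 4 (uncurry (pd2 V)) := hV.uncurry_pd2 (by norm_num)
    have h12 := pd1_pd2_comm (hV.of_le (by norm_num : (2 : WithTop ℕ∞) ≤ 5))
    exact ⟨h12, by rw [pd1_pd2_comm (h2.of_le (by norm_num)), h12]⟩
  have boundary {V : ℝ → ℝ → ℝ} (hV : ∀ s, V (-L) s = 0) : pd2 V (-L) t = 0 := by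
    simp [pd2, hV]
  obtain ⟨hU0, hU1, hU2, hU21, hU221⟩ := smooth hU
  obtain ⟨hW0, hW1, hW2, hW21, hW221⟩ := smooth hW
  obtain ⟨cU, cU'⟩ := comm hU
  obtain ⟨cW, cW'⟩ := comm hW
  have d1 {V : ℝ → ℝ → ℝ} (hV : ContDiff ℝ 1 (uncurry V)) :=
    hasDerivAt_pd1 (hV.differentiable one_ne_zero)
  have d2 {V : ℝ → ℝ → ℝ} (hV : ContDiff ℝ 1 (uncurry V)) :=
    hasDerivAt_pd2 (hV.differentiable one_ne_zero)
  rw [deriv_integral_of_pd2_eq_pd1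
    (g := fun x s => pd2 U x s * (pd1 U x s + (ε / 2) * (pd1 U x s) ^ 2
          + ε * pd2 (pd2 (pd1 U)) x s)
        + pd2 W x s * ((δ * c ^ 2 / γ) * pd1 W x s
          + (ε * α * δ / (2 * γ)) * (pd1 W x s) ^ 2
          + (ε * β * δ / γ) * pd2 (pd2 (pd1 W)) x s))]
  · simp only [boundary hUb, boundary hWb]
    ring
  · simp only [uncurry_def] at *
    fun_prop
  · simp only [uncurry_def] at *
    fun_prop
  · intro x s
    have hE := (((((((((d2 hU2 x s).pow 2).add (((d2 hW2 x s).pow 2).const_mul (δ / γ))).add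
      ((d2 hU1 x s).pow 2)).add (((d2 hW1 x s).pow 2).const_mul (δ * c ^ 2 / γ))).add
      ((((d2 hU1 x s).pow 3).add (((d2 hW1 x s).pow 3).const_mul (α * δ / γ))).const_mul
        (ε / 3))).add (((d2 hU21 x s).pow 2).const_mul ε)).add
      (((d2 hW21 x s).pow 2).const_mul (ε * β * δ / γ))).add
      ((((d2 hU0 x s).sub (d2 hW0 x s)).pow 2).const_mul (ε * δ))).const_mul (1 / 2)
    have hF := ((d1 hU2 x s).mul (((d1 hU1 x s).add (((d1 hU1 x s).pow 2).const_mul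
      (ε / 2))).add ((d1 hU221 x s).const_mul ε))).add
      ((d1 hW2 x s).mul ((((d1 hW1 x s).const_mul (δ * c ^ 2 / γ)).add
        (((d1 hW1 x s).pow 2).const_mul (ε * α * δ / (2 * γ)))).add
        ((d1 hW221 x s).const_mul (ε * β * δ / γ))))
    refine hE.deriv.trans (Eq.trans ?_ hF.deriv.symm)
    obtain ⟨eU, eW⟩ := hsys x s
    rw [cU'] at eU
    rw [cW'] at eW
    simp only [Pi.add_apply, Pi.sub_apply, Pi.pow_apply, cU, cW]
    field_simp
    push_cast
    linear_combination (6 * γ * pd2 U x s) * eU + (6 * δ * pd2 W x s) * eW
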